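/- Let 0 < α < 1 and let (x_n) be a sequence in [0,1) such that for all s > 0, lim_{N→∞} (1/N^{2-α}) #{1 ≤ m ≠ n ≤ N : ‖x_m - x_n‖ ≤ s/N^α} = 2s. Then (x_n) is uniformly distributed mod 1. -/

import Mathlib

open Real Filter Finset

/-- Uniform distribution mod 1 in the sense of Weyl's criterion. -/
def WeylUD (x : ℕ → ℝ) : Prop :=
  ∀ ℓ : ℤ, ℓ ≠ 0 →
    Filter.Tendsto (fun N : ℕ => (1 / (N : ℂ)) * ∑ n ∈ Finset.range N,
      Complex.exp (2 * (Real.pi : ℂ) * Complex.I * (ℓ : ℂ) * (x n : ℂ))) Filter.atTop (nhds 0)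

/-- Distance to the nearest integer. -/
noncomputable def distNearestInt (y : ℝ) : ℝ := |y - round y|

open MeasureTheory

theorem AddCircle.measureReal_closedBall_inter_closedBall_le (a b : UnitAddCircle) {w : ℝ}
    (hw : w ≤ 1 / 3) :
    volume.real (Metric.closedBall a (w / 2) ∩ Metric.closedBall b (w / 2)) ≤
      max (w - ‖a - b‖) 0 := by
  by_cases hab : ‖a - b‖ ≤ w
  swap
  · have : Metric.closedBall a (w / 2) ∩ Metric.closedBall b (w / 2) = ∅ := by
      rw [Set.eq_empty_iff_forall_notMem]
      rintro t ⟨h1, h2⟩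
      apply hab
      rw [← dist_eq_norm]
      have := dist_triangle_left a b t
      rw [Metric.mem_closedBall] at h1 h2
      linarith
    simp [this]
  obtain ⟨b, rfl⟩ := QuotientAddGroup.mk_surjective b
  obtain ⟨y, hy, hya⟩ : ∃ y : ℝ, |y| = ‖a - (b : UnitAddCircle)‖ ∧
      a = ((b + y : ℝ) : UnitAddCircle) := by
    obtain ⟨z, hz⟩ := QuotientAddGroup.mk_surjective (a - (b : UnitAddCircle))
    refine ⟨z - round z, ?_, ?_⟩
    · rw [← hz]
      exact UnitAddCircle.norm_eq.symm
    · have h2 : ((z - round z : ℝ) : UnitAddCircle) = a - (b : UnitAddCircle) := by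
        rw [← hz]
        have : ((round z : ℝ) : UnitAddCircle) = 0 := by
          rw [AddCircle.coe_eq_zero_iff]
          exact ⟨round z, by simp⟩
        rw [AddCircle.coe_sub, this, sub_zero]
      rw [AddCircle.coe_add, h2]
      abel
  have hsub : (QuotientAddGroup.mk ⁻¹' (Metric.closedBall a (w / 2) ∩
      Metric.closedBall (b : UnitAddCircle) (w / 2)) : Set ℝ) ∩
      Set.Ioc (b - 1 / 2) (b - 1 / 2 + 1) ⊆
      Set.Icc (max (b + y) b - w / 2) (min (b + y) b + w / 2) := by
    rintro t ⟨⟨h1, h2⟩, h3, h4⟩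
    have key : ∀ c : ℝ, |t - c| ≤ 1 / 2 →
        dist (t : UnitAddCircle) (c : UnitAddCircle) ≤ w / 2 → |t - c| ≤ w / 2 := by
      intro c hc h
      rw [dist_eq_norm, ← AddCircle.coe_sub,
        (AddCircle.norm_coe_eq_abs_iff 1 one_ne_zero).2 (by simpa using hc)] at h
      exact h
    have hb := key b (abs_le.2 ⟨by linarith, by linarith⟩) h2
    have hy' : |y| ≤ w := hy ▸ hab
    rw [abs_le] at hb hy'
    have ha := key (b + y) (abs_le.2 ⟨by linarith, by linarith⟩) (hya ▸ h1)
    rw [abs_le] at ha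
    constructor
    · rw [sub_le_iff_le_add, max_le_iff]
      constructor <;> linarith
    · rw [← sub_le_iff_le_add, le_min_iff]
      constructor <;> linarith
  rw [measureReal_def, AddCircle.add_projection_respects_measure 1 (b - 1 / 2)
    (measurableSet_closedBall.inter measurableSet_closedBall)]
  refine (ENNReal.toReal_mono (by simp) (measure_mono hsub)).trans ?_
  rw [Real.volume_Icc, ENNReal.toReal_ofReal']
  refine max_le_max (le_of_eq ?_) le_rfl
  change _ = w - ‖a - (b : UnitAddCircle)‖
  rw [← hy]
  rcases le_total 0 y with h | h
  · rw [max_eq_left (by linarith), min_eq_right (by linarith), abs_of_nonneg h]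
    ring
  · rw [max_eq_right (by linarith), min_eq_left (by linarith), abs_of_nonpos h]
    ring

theorem AddCircle.measureReal_closedBall (a : UnitAddCircle) {w : ℝ} (hw0 : 0 ≤ w)
    (hw : w ≤ 1) : volume.real (Metric.closedBall a (w / 2)) = w := by
  rw [measureReal_def, AddCircle.volume_closedBall, ENNReal.toReal_ofReal]
  · rw [min_eq_right] <;> linarith
  · exact le_min (by norm_num) (by linarith)

theorem setIntegral_closedBall_fourier (ℓ : ℤ) (a : UnitAddCircle) (r : ℝ) :
    ∫ t in Metric.closedBall a r, fourier ℓ t =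
      fourier ℓ a * ∫ t in Metric.closedBall (0 : UnitAddCircle) r, fourier ℓ t := by
  rw [← integral_const_mul, ← integral_indicator measurableSet_closedBall,
    ← integral_indicator measurableSet_closedBall, ← integral_add_left_eq_self _ a]
  congr 1
  ext t
  have : fourier ℓ (a + t) = fourier ℓ a * fourier ℓ t := by
    simp [fourier_apply, smul_add, AddCircle.toCircle_add]
  simp [Set.indicator, this]

theorem norm_integral_mul_sq_le_of_integral_eq_zero {Ω : Type*} [MeasurableSpace Ω]
    {μ : Measure Ω} [IsProbabilityMeasure μ] {F : Ω → ℝ} {e : Ω → ℂ} (hF : MemLp F 2 μ)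
    (he : AEStronglyMeasurable e μ) (he1 : ∀ t, ‖e t‖ ≤ 1) (he0 : ∫ t, e t ∂μ = 0) :
    ‖∫ t, (F t : ℂ) * e t ∂μ‖ ^ 2 ≤ ∫ t, F t ^ 2 ∂μ - (∫ t, F t ∂μ) ^ 2 := by
  set c := ∫ t, F t ∂μ
  have hG : MemLp (fun t => F t - c) 2 μ := hF.sub (memLp_const c)
  have hFi : Integrable F μ := hF.integrable one_le_two
  have hei : Integrable e μ :=
    Integrable.of_bound he 1 (Eventually.of_forall he1)
  have hFe : Integrable (fun t => (F t : ℂ) * e t) μ :=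
    hFi.ofReal.mul_bdd (c := 1) he (Eventually.of_forall he1)
  have h1 : ∫ t, (F t : ℂ) * e t ∂μ = ∫ t, ((F t - c : ℝ) : ℂ) * e t ∂μ := by
    have : ∀ t, ((F t - c : ℝ) : ℂ) * e t = (F t : ℂ) * e t - (c : ℂ) * e t := by
      intro t
      push_cast
      ring
    simp_rw [this]
    rw [integral_sub hFe (hei.const_mul _), integral_const_mul, he0, mul_zero, sub_zero]
  have h2 : ‖∫ t, (F t : ℂ) * e t ∂μ‖ ≤ ∫ t, |F t - c| ∂μ := by
    rw [h1]
    refine norm_integral_le_of_norm_le (hG.integrable one_le_two).abs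
      (Eventually.of_forall fun t => ?_)
    rw [norm_mul, Complex.norm_real, Real.norm_eq_abs]
    exact mul_le_of_le_one_right (abs_nonneg _) (he1 t)
  have h3 : (∫ t, |F t - c| ∂μ) ^ 2 ≤ ∫ t, |F t - c| ^ 2 ∂μ := by
    have h := ProbabilityTheory.variance_nonneg (fun t => |F t - c|) μ
    rw [ProbabilityTheory.variance_eq_sub (X := fun t => |F t - c|) hG.abs] at h
    simpa using h
  have h4 : ∫ t, |F t - c| ^ 2 ∂μ = ∫ t, F t ^ 2 ∂μ - c ^ 2 := by
    have h := ProbabilityTheory.variance_eq_integral hFi.aemeasurable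
    rw [ProbabilityTheory.variance_eq_sub hF] at h
    simpa [sq_abs] using h.symm
  calc _ ≤ (∫ t, |F t - c| ∂μ) ^ 2 := by gcongr
    _ ≤ _ := h3.trans h4.le

theorem max_one_sub_le_card_filter_div {d : ℝ} (hd : 0 ≤ d) {k : ℕ} (hk : 0 < k) :
    max (1 - d) 0 ≤
      (1 / k : ℝ) * ∑ i ∈ range k, if d ≤ ((i : ℝ) + 1) / k then (1 : ℝ) else 0 := by
  have hk' : (0 : ℝ) < k := by exact_mod_cast hk
  refine max_le ?_ (mul_nonneg (by positivity) (sum_nonneg fun i _ => by split_ifs <;> simp))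
  rw [sum_boole]
  have hsub : Finset.Ico (⌈d * k⌉₊ - 1) k ⊆
      (range k).filter fun i : ℕ => d ≤ ((i : ℝ) + 1) / k := by
    intro i hi
    rw [Finset.mem_Ico] at hi
    rw [mem_filter, Finset.mem_range, le_div_iff₀ hk']
    refine ⟨hi.2, (Nat.le_ceil _).trans ?_⟩
    have : ⌈d * k⌉₊ ≤ i + 1 := by omega
    exact_mod_cast this
  have hcard := card_le_card hsub
  rw [Nat.card_Ico] at hcard
  have h1 : ((⌈d * k⌉₊ - 1 : ℕ) : ℝ) ≤ d * k := by
    rcases Nat.eq_zero_or_pos ⌈d * k⌉₊ with h | h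
    · rw [h]
      simp only [zero_tsub, Nat.cast_zero]
      positivity
    · rw [Nat.cast_sub h]
      have := Nat.ceil_lt_add_one (a := d * k) (by positivity)
      push_cast
      linarith
  have h2 : (k : ℝ) ≤ (k - (⌈d * k⌉₊ - 1) : ℕ) + ((⌈d * k⌉₊ - 1 : ℕ) : ℝ) := by
    norm_cast
    omega
  have h3 : ((k - (⌈d * k⌉₊ - 1) : ℕ) : ℝ) ≤
      (((range k).filter fun i : ℕ => d ≤ ((i : ℝ) + 1) / k).card : ℝ) := by
    exact_mod_cast hcard
  rw [one_div, inv_mul_eq_div, le_div_iff₀ hk']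
  linarith

theorem norm_sum_fourier_sq_mul_le {ι : Type*} (s : Finset ι)
    (a : ι → UnitAddCircle) {ℓ : ℤ} (hℓ : ℓ ≠ 0) {w : ℝ} (hw0 : 0 < w) (hw : w ≤ 1 / 3)
    (hκ : ∀ t : UnitAddCircle, ‖t‖ ≤ w / 2 → ‖fourier ℓ t - 1‖ ≤ 1 / 2) :
    ‖∑ i ∈ s, fourier ℓ (a i)‖ ^ 2 * (w / 2) ^ 2 ≤
      ∑ p ∈ s ×ˢ s, max (w - ‖a p.1 - a p.2‖) 0 - (s.card * w) ^ 2 := by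
  have : IsProbabilityMeasure (volume : Measure UnitAddCircle) :=
    ⟨by simp [AddCircle.measure_univ]⟩
  set B : ι → Set UnitAddCircle := fun i => Metric.closedBall (a i) (w / 2)
  have hBm : ∀ i, MeasurableSet (B i) := fun i => measurableSet_closedBall
  have hBi : ∀ i, Integrable ((B i).indicator (1 : UnitAddCircle → ℝ)) :=
    fun i => (integrable_const (1 : ℝ)).indicator (hBm i)
  set F : UnitAddCircle → ℝ := fun t => ∑ i ∈ s, (B i).indicator 1 t with hF
  set κ : ℂ := ∫ t in Metric.closedBall (0 : UnitAddCircle) (w / 2), fourier ℓ t with hκdef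
  have hei : Integrable (fun t : UnitAddCircle => fourier ℓ t) :=
    (fourier ℓ).continuous.integrable_of_hasCompactSupport
      (HasCompactSupport.of_compactSpace _)
  have hFLp : MemLp F 2 volume :=
    memLp_finsetSum _ fun i _ => (memLp_const (1 : ℝ)).indicator (hBm i)
  have hFint : ∫ t, F t = s.card * w := by
    rw [integral_finsetSum _ fun i _ => hBi i]
    simp_rw [integral_indicator_one (hBm _), B,
      AddCircle.measureReal_closedBall _ hw0.le (by linarith : w ≤ 1)]
    simp
  have hF2 : ∫ t, F t ^ 2 ≤ ∑ p ∈ s ×ˢ s, max (w - ‖a p.1 - a p.2‖) 0 := by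
    have h : ∀ t, F t ^ 2 = ∑ p ∈ s ×ˢ s, (B p.1 ∩ B p.2).indicator (1 : UnitAddCircle → ℝ) t := by
      intro t
      rw [sq, hF, sum_mul_sum, ← sum_product']
      simp_rw [Set.inter_indicator_one, Pi.mul_apply]
    simp_rw [h]
    have hBBi : ∀ p : ι × ι,
        Integrable ((B p.1 ∩ B p.2).indicator (1 : UnitAddCircle → ℝ)) :=
      fun p => (integrable_const (1 : ℝ)).indicator ((hBm p.1).inter (hBm p.2))
    rw [integral_finsetSum _ fun p _ => hBBi p]
    refine sum_le_sum fun p _ => ?_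
    rw [integral_indicator_one ((hBm p.1).inter (hBm p.2))]
    exact AddCircle.measureReal_closedBall_inter_closedBall_le _ _ hw
  have hFe : ∫ t, (F t : ℂ) * fourier ℓ t = (∑ i ∈ s, fourier ℓ (a i)) * κ := by
    have h : ∀ t, (F t : ℂ) * fourier ℓ t =
        ∑ i ∈ s, (B i).indicator (fun t => (fourier ℓ t : ℂ)) t := by
      intro t
      rw [hF]
      push_cast
      rw [sum_mul]
      refine sum_congr rfl fun i _ => ?_
      by_cases ht : t ∈ B i <;> simp [ht]
    simp_rw [h]
    rw [integral_finsetSum _ fun i _ => hei.indicator (hBm i), sum_mul]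
    refine sum_congr rfl fun i _ => ?_
    rw [integral_indicator (hBm i), setIntegral_closedBall_fourier]
  have hκw : w / 2 ≤ ‖κ‖ := by
    have hvol := AddCircle.measureReal_closedBall 0 hw0.le (by linarith : w ≤ 1)
    have h1 : κ - w = ∫ t in Metric.closedBall (0 : UnitAddCircle) (w / 2),
        (fourier ℓ t - 1) := by
      rw [integral_sub hei.integrableOn (integrable_const _).integrableOn, setIntegral_const,
        hvol]
      simp [hκdef]
    have h2 : ‖κ - w‖ ≤ 1 / 2 * w := by
      rw [h1]
      refine (norm_setIntegral_le_of_norm_le_const (measure_lt_top _ _)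
        fun t ht => hκ t ?_).trans_eq (by rw [hvol])
      simpa using ht
    have h3 : ‖(w : ℂ)‖ = w := by simp [abs_of_pos hw0]
    have h4 := norm_sub_norm_le (w : ℂ) κ
    rw [norm_sub_rev] at h4
    linarith
  have he0 : ∫ t : UnitAddCircle, fourier ℓ t = 0 :=
    integral_eq_zero_of_add_right_eq_neg (fourier_add_half_inv_index hℓ one_pos)
  have hmain := norm_integral_mul_sq_le_of_integral_eq_zero hFLp hei.aestronglyMeasurable
    (fun t => ((fourier ℓ).norm_coe_le_norm t).trans (fourier_norm ℓ).le) he0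
  rw [hFe, hFint, norm_mul, mul_pow] at hmain
  calc _ ≤ ‖∑ i ∈ s, fourier ℓ (a i)‖ ^ 2 * ‖κ‖ ^ 2 := by gcongr
    _ ≤ _ := hmain
    _ ≤ _ := by gcongr

theorem sum_max_sub_norm_le {ι : Type*} [DecidableEq ι] (s : Finset ι) (a : ι → UnitAddCircle)
    {w : ℝ} (hw0 : 0 < w) {k : ℕ} (hk : 0 < k) :
    ∑ p ∈ s ×ˢ s, max (w - ‖a p.1 - a p.2‖) 0 ≤ s.card * w + w * ((1 / k : ℝ) *
      ∑ i ∈ range k, (((s ×ˢ s).filter fun p => p.1 ≠ p.2 ∧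
        ‖a p.1 - a p.2‖ ≤ ((i : ℝ) + 1) / k * w).card : ℝ)) := by
  have hdiag : ∑ p ∈ s ×ˢ s, (if p.1 = p.2 then w else 0) = s.card * w := by
    rw [sum_product]
    simp [sum_ite_eq]
  have hcard : ∀ i : ℕ, (((s ×ˢ s).filter fun p => p.1 ≠ p.2 ∧
      ‖a p.1 - a p.2‖ ≤ ((i : ℝ) + 1) / k * w).card : ℝ) =
      ∑ p ∈ s ×ˢ s, if p.1 ≠ p.2 ∧ ‖a p.1 - a p.2‖ ≤ ((i : ℝ) + 1) / k * w
        then (1 : ℝ) else 0 := fun i => (sum_boole _ _).symm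
  simp_rw [hcard]
  rw [sum_comm, mul_sum, mul_sum, ← hdiag, ← sum_add_distrib]
  refine sum_le_sum fun p _ => ?_
  by_cases hp : p.1 = p.2
  · simp [hp, hw0.le]
  · have h := max_one_sub_le_card_filter_div
      (div_nonneg (norm_nonneg (a p.1 - a p.2)) hw0.le) hk
    simp_rw [div_le_iff₀ hw0] at h
    have hmax : max (w - ‖a p.1 - a p.2‖) 0 = w * max (1 - ‖a p.1 - a p.2‖ / w) 0 := by
      rw [mul_max_of_nonneg _ _ hw0.le, mul_zero, mul_sub, mul_one, mul_div_cancel₀ _ hw0.ne']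
    rw [hmax]
    simp only [hp, if_false, zero_add, ne_eq, not_false_eq_true, true_and]
    gcongr

theorem tendsto_norm_sum_fourier_div_zero {α : ℝ} (hα0 : 0 < α) (hα1 : α < 1)
    (a : ℕ → UnitAddCircle)
    (hpc : ∀ s : ℝ, 0 < s →
      Tendsto (fun N : ℕ => (1 / (N : ℝ) ^ ((2:ℝ) - α)) *
        (((range N ×ˢ range N).filter
          (fun p => p.1 ≠ p.2 ∧ ‖a p.1 - a p.2‖ ≤ s / (N : ℝ) ^ α)).card : ℝ))
        atTop (nhds (2 * s))) {ℓ : ℤ} (hℓ : ℓ ≠ 0) :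
    Tendsto (fun N : ℕ => ‖∑ n ∈ range N, fourier ℓ (a n)‖ / N) atTop (nhds 0) := by
  obtain ⟨δ, hδ, hfδ⟩ : ∃ δ > 0, ∀ t : UnitAddCircle, ‖t‖ < δ → ‖fourier ℓ t - 1‖ ≤ 1 / 2 := by
    obtain ⟨δ, hδ, h⟩ := Metric.continuousAt_iff.1
      ((fourier ℓ).continuous.continuousAt (x := (0 : UnitAddCircle))) (1 / 2) (by norm_num)
    refine ⟨δ, hδ, fun t ht => ?_⟩
    have := h (x := t) (by simpa using ht)
    rw [fourier_eval_zero, dist_eq_norm] at this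
    exact this.le
  have hNα : Tendsto (fun N : ℕ => 1 / (N : ℝ) ^ α) atTop (nhds 0) := by
    simp_rw [one_div]
    exact ((tendsto_rpow_atTop hα0).comp tendsto_natCast_atTop_atTop).inv_tendsto_atTop
  have hN1 : Tendsto (fun N : ℕ => 1 / (N : ℝ) ^ (1 - α)) atTop (nhds 0) := by
    simp_rw [one_div]
    exact ((tendsto_rpow_atTop (sub_pos.2 hα1)).comp
      tendsto_natCast_atTop_atTop).inv_tendsto_atTop
  set R : ℝ → ℕ → ℝ := fun s N => (1 / (N : ℝ) ^ ((2:ℝ) - α)) *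
        (((range N ×ˢ range N).filter
          (fun p => p.1 ≠ p.2 ∧ ‖a p.1 - a p.2‖ ≤ s / (N : ℝ) ^ α)).card : ℝ)
  have hbound : ∀ k : ℕ, 0 < k → ∀ᶠ N : ℕ in atTop,
      (‖∑ n ∈ range N, fourier ℓ (a n)‖ / N) ^ 2 ≤ 4 * (1 / (N : ℝ) ^ (1 - α) +
        (1 / k : ℝ) * ∑ i ∈ range k, R (((i : ℝ) + 1) / k) N - 1) := by
    intro k hk
    filter_upwards [hNα.eventually_lt_const (show (0 : ℝ) < min (1 / 3) δ by positivity),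
      eventually_gt_atTop 0] with N hN hNpos
    have hN' : (0 : ℝ) < N := by exact_mod_cast hNpos
    rw [lt_min_iff] at hN
    set w : ℝ := 1 / (N : ℝ) ^ α with hw
    have hw0 : 0 < w := by positivity
    have h1 := norm_sum_fourier_sq_mul_le (range N) a hℓ hw0 hN.1.le
      fun t ht => hfδ t (by linarith [hN.2])
    have h2 := sum_max_sub_norm_le (range N) a hw0 hk
    rw [card_range] at h1 h2
    have hR : ∀ i : ℕ, (((range N ×ˢ range N).filter fun p => p.1 ≠ p.2 ∧
        ‖a p.1 - a p.2‖ ≤ ((i : ℝ) + 1) / k * w).card : ℝ) =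
        (N : ℝ) ^ 2 * w * R (((i : ℝ) + 1) / k) N := by
      intro i
      have : (N : ℝ) ^ 2 * w * (1 / (N : ℝ) ^ ((2:ℝ) - α)) = 1 := by
        rw [hw, Real.rpow_sub hN', Real.rpow_two]
        field_simp
      simp only [R]
      rw [← mul_assoc, this, one_mul, hw, mul_one_div]
    simp_rw [hR] at h2
    rw [← mul_sum] at h2
    have hNw : 1 / (N : ℝ) ^ (1 - α) = 1 / (N * w) := by
      rw [Real.rpow_sub hN', Real.rpow_one, hw, mul_one_div]
    rw [hNw, div_pow, div_le_iff₀ (by positivity)]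
    have h3 : ‖∑ i ∈ range N, fourier ℓ (a i)‖ ^ 2 * (w / 2) ^ 2 ≤
        (4 * (1 / (N * w) + 1 / (k : ℝ) * ∑ i ∈ range k, R (((i : ℝ) + 1) / k) N - 1) *
          (N : ℝ) ^ 2) * (w / 2) ^ 2 := by
      refine (h1.trans (sub_le_sub_right h2 _)).trans_eq ?_
      field_simp
      ring
    exact le_of_mul_le_mul_right h3 (by positivity)
  have hlim : ∀ k : ℕ, 0 < k → Tendsto (fun N : ℕ => 4 * (1 / (N : ℝ) ^ (1 - α) +
        (1 / k : ℝ) * ∑ i ∈ range k, R (((i : ℝ) + 1) / k) N - 1)) atTop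
        (nhds (4 * (1 / k : ℝ))) := by
    intro k hk
    have hk' : (0 : ℝ) < k := by exact_mod_cast hk
    have h := ((hN1.add ((tendsto_finsetSum (range k) fun i _ =>
      hpc (((i : ℝ) + 1) / k) (by positivity)).const_mul (1 / k : ℝ))).sub_const 1).const_mul 4
    convert h using 2
    have hs : ∑ i ∈ range k, 2 * (((i : ℝ) + 1) / k) = k + 1 := by
      have : ∀ n : ℕ, ∑ i ∈ range n, 2 * (((i : ℝ) + 1) / k) = n * (n + 1) / k := by
        intro n
        induction n with
        | zero => simp
        | succ n ih =>
          rw [sum_range_succ, ih]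
          push_cast
          ring
      rw [this]
      field_simp
    rw [hs]
    field_simp
    ring
  rw [Metric.tendsto_atTop']
  intro ε hε
  obtain ⟨k, hk⟩ := exists_nat_one_div_lt (show 0 < ε ^ 2 / 4 by positivity)
  have hk1 : 4 * (1 / ((k + 1 : ℕ) : ℝ)) < ε ^ 2 := by
    push_cast
    linarith
  have hev := (hbound (k + 1) k.succ_pos).and
    ((hlim (k + 1) k.succ_pos).eventually_lt_const hk1)
  obtain ⟨M, hM⟩ := eventually_atTop.1 hev
  refine ⟨M, fun N hN => ?_⟩
  have h := (hM N hN.le).1.trans_lt (hM N hN.le).2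
  rw [Real.dist_0_eq_abs]
  exact abs_lt_of_sq_lt_sq h hε.le

theorem stmt_12 (α : ℝ) (hα0 : 0 < α) (hα1 : α < 1)
    (x : ℕ → ℝ) (hx : ∀ n, x n ∈ Set.Ico (0:ℝ) 1)
    (hpc : ∀ s : ℝ, 0 < s →
      Tendsto (fun N : ℕ => (1 / (N : ℝ) ^ ((2:ℝ) - α)) *
        ((Finset.range N ×ˢ Finset.range N).filter
          (fun p => p.1 ≠ p.2 ∧ distNearestInt (x p.1 - x p.2) ≤ s / (N : ℝ) ^ α)).card)
        atTop (nhds (2 * s))) :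
    WeylUD x := by
  intro ℓ hℓ
  have hpc' : ∀ s : ℝ, 0 < s →
      Tendsto (fun N : ℕ => (1 / (N : ℝ) ^ ((2:ℝ) - α)) *
        (((range N ×ˢ range N).filter (fun p => p.1 ≠ p.2 ∧
          ‖(x p.1 : UnitAddCircle) - (x p.2 : UnitAddCircle)‖ ≤ s / (N : ℝ) ^ α)).card : ℝ))
        atTop (nhds (2 * s)) := by
    intro s hs
    refine (hpc s hs).congr fun N => ?_
    congr 3
    ext p
    rw [mem_filter, mem_filter]
    simp only [← AddCircle.coe_sub, UnitAddCircle.norm_eq, distNearestInt]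
  refine squeeze_zero_norm (fun N => le_of_eq ?_) (tendsto_norm_sum_fourier_div_zero hα0 hα1
    (fun n => (x n : UnitAddCircle)) hpc' hℓ)
  simp only [fourier_coe_apply, Complex.ofReal_one, div_one, norm_mul, norm_div, norm_one,
    Complex.norm_natCast]
  ring
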